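/- (1) For any n ≥ 2, the Zariski closure of O(k^{n−2}⋊E_4) equals O(k^{n−2}⋊E_4) ∪ O(p^-) ∪ O(k^n) ∪ (∪_{α∈k} O(ν^α)). (2) For any m ≥ 1 and n ≥ 2m+1, the Zariski closure of O(η_m ⊕ k^{n−2m−1}) equals (∪_{1≤l≤m} O(η_l ⊕ k^{n−2l−1})) ∪ O(k^n). -/

import Mathlib

open scoped BigOperators

noncomputable section

/-- The space of `n`-dimensional (nonassociative) algebra structures on `kⁿ`:
bilinear maps `kⁿ × kⁿ → kⁿ`. -/
abbrev AlgStr (k : Type*) [Field k] (n : ℕ) : Type _ :=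
  (Fin n → k) →ₗ[k] (Fin n → k) →ₗ[k] (Fin n → k)

variable {k : Type*} [Field k]

/-- The algebra structure with prescribed structure constants `c`:
`μ(x, y) m = ∑ i, ∑ j, x i * y j * c i j m`. -/
def ofConst {n : ℕ} (c : Fin n → Fin n → Fin n → k) : AlgStr k n :=
  ∑ i, ∑ j,
    ((LinearMap.mul k k).compl₁₂ (LinearMap.proj i) (LinearMap.proj j)).compr₂
      (LinearMap.toSpanSingleton k (Fin n → k) (c i j))

/-- The structure constants of an algebra structure in the standard basis. -/
def structConst {n : ℕ} (μ : AlgStr k n) : Fin n × Fin n × Fin n → k :=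
  fun t => μ (Pi.single t.1 1) (Pi.single t.2.1 1) t.2.2

/-- A subset of `AlgStr k n` is Zariski closed if it is the common zero locus of a
family of polynomials in the structure constants. -/
def IsZariskiClosed {n : ℕ} (S : Set (AlgStr k n)) : Prop :=
  ∃ P : Set (MvPolynomial (Fin n × Fin n × Fin n) k),
    ∀ μ : AlgStr k n, μ ∈ S ↔ ∀ p ∈ P, MvPolynomial.eval (structConst μ) p = 0

/-- The action of `GL(V)` on algebra structures: `(g • μ)(x,y) = g (μ (g⁻¹ x) (g⁻¹ y))`. -/
def transport {n : ℕ} (g : (Fin n → k) ≃ₗ[k] (Fin n → k)) (μ : AlgStr k n) :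
    AlgStr k n :=
  ((μ.comp g.symm.toLinearMap).compl₂ g.symm.toLinearMap).compr₂ g.toLinearMap

/-- The `GL(V)`-orbit of an algebra structure; two structures represent isomorphic
algebras iff they lie in the same orbit. -/
def orbit {n : ℕ} (μ : AlgStr k n) : Set (AlgStr k n) :=
  {χ | ∃ g : (Fin n → k) ≃ₗ[k] (Fin n → k), transport g μ = χ}

/-- The Zariski closure of a set of algebra structures. -/
def zclosure {n : ℕ} (S : Set (AlgStr k n)) : Set (AlgStr k n) :=
  {χ | ∀ T : Set (AlgStr k n), IsZariskiClosed T → S ⊆ T → χ ∈ T}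

/-- `μ` degenerates to `χ` if `χ` lies in the Zariski closure of the orbit of `μ`. -/
def degenerates {n : ℕ} (μ χ : AlgStr k n) : Prop :=
  χ ∈ zclosure (orbit μ)

/-- A proper degeneration: additionally `χ` is not isomorphic to `μ`. -/
def properlyDegenerates {n : ℕ} (μ χ : AlgStr k n) : Prop :=
  degenerates μ χ ∧ χ ∉ orbit μ

/-- There is a chain of `m` proper degenerations starting at `μ`. -/
def hasChain {n : ℕ} (μ : AlgStr k n) (m : ℕ) : Prop :=
  ∃ c : ℕ → AlgStr k n, c m = μ ∧ ∀ i < m, properlyDegenerates (c (i + 1)) (c i)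

/-- The level of `μ` is `m`: there is a chain of `m` proper degenerations starting
at `μ` but no chain of `m+1`. -/
def levelIs {n : ℕ} (μ : AlgStr k n) (m : ℕ) : Prop :=
  hasChain μ m ∧ ¬ hasChain μ (m + 1)

/-- The subalgebra generated by a set `s`. -/
def subalgGen {n : ℕ} (μ : AlgStr k n) (s : Set (Fin n → k)) :
    Submodule k (Fin n → k) :=
  sInf {W | s ⊆ W ∧ ∀ x ∈ W, ∀ y ∈ W, μ x y ∈ W}

/-- The generation type of `μ` is `m`: `m` is the maximal dimension of a
one-generated subalgebra. -/
def genType {n : ℕ} (μ : AlgStr k n) (m : ℕ) : Prop :=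
  IsGreatest {d : ℕ | ∃ a : Fin n → k, Module.finrank k ↥(subalgGen μ {a}) = d} m

/-- A standard `1`-generated algebra: it admits a grading `A = ⊕_{i ≥ 1} A_i` with
`dim A_1 = 1`, `A_i A_j ⊆ A_{i+j}`, generated by `A_1` as an algebra. -/
def StandardOneGenerated {m : ℕ} (μ : AlgStr k m) : Prop :=
  ∃ A : ℕ → Submodule k (Fin m → k),
    A 0 = ⊥ ∧ DirectSum.IsInternal A ∧ Module.finrank k ↥(A 1) = 1 ∧
    (∀ i j : ℕ, ∀ x ∈ A i, ∀ y ∈ A j, μ x y ∈ A (i + j)) ∧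
    subalgGen μ ((A 1 : Submodule k (Fin m → k)) : Set (Fin m → k)) = ⊤

/-- Extension by zero of coordinates, `kᵐ → kⁿ`. -/
def inclMap (k : Type*) [Field k] {m n : ℕ} (h : m ≤ n) :
    (Fin m → k) →ₗ[k] (Fin n → k) where
  toFun x i := if hi : (i : ℕ) < m then x ⟨i, hi⟩ else 0
  map_add' x y := by funext i; by_cases hi : (i : ℕ) < m <;> simp [hi]
  map_smul' a x := by funext i; by_cases hi : (i : ℕ) < m <;> simp [hi]

/-- The `n`-dimensional algebra `B ⊕ k^{n-m}` obtained from an `m`-dimensional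
algebra `B` by adjoining a complement with all products zero. -/
def extendZero {m n : ℕ} (h : m ≤ n) (B : AlgStr k m) : AlgStr k n :=
  ((B.comp (LinearMap.funLeft k k (Fin.castLE h))).compl₂
      (LinearMap.funLeft k k (Fin.castLE h))).compr₂ (inclMap k h)

/-- The `i`-th standard basis vector (as a plain function, `0` if `i ≥ n`). -/
def unitVec {k : Type*} [Field k] (n i : ℕ) : Fin n → k :=
  fun j => if (j : ℕ) = i then 1 else 0

/-- Projection onto the coordinate `0` part. -/
def proj0 (k : Type*) [Field k] (n : ℕ) : (Fin n → k) →ₗ[k] (Fin n → k) :=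
  LinearMap.pi fun i => if (i : ℕ) = 0 then LinearMap.proj i else 0

/-- Projection onto the coordinates `≥ 1` part. -/
def projPos (k : Type*) [Field k] (n : ℕ) : (Fin n → k) →ₗ[k] (Fin n → k) :=
  LinearMap.pi fun i => if (i : ℕ) = 0 then 0 else LinearMap.proj i

/-- The Inönü–Wigner contraction of `μ` with respect to the `1`-dimensional
subalgebra spanned by the first basis vector (the remaining coordinates form the
square-zero ideal part). -/
def IWcontract0 {n : ℕ} (μ : AlgStr k n) : AlgStr k n :=
  ((μ.comp (projPos k n)).compl₂ (proj0 k n)).compr₂ (projPos k n) +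
    ((μ.comp (proj0 k n)).compl₂ (projPos k n)).compr₂ (projPos k n) +
    (μ.comp (proj0 k n)).compl₂ (proj0 k n)

/-- The annihilator of an algebra structure. -/
def annihilator {n : ℕ} (μ : AlgStr k n) : Submodule k (Fin n → k) where
  carrier := {a | ∀ b, μ a b = 0 ∧ μ b a = 0}
  add_mem' := by
    intro a b ha hb
    intro c
    constructor
    · rw [map_add, LinearMap.add_apply, (ha c).1, (hb c).1, add_zero]
    · rw [map_add, (ha c).2, (hb c).2, add_zero]
  zero_mem' := by
    intro b
    constructor
    · rw [map_zero, LinearMap.zero_apply]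
    · rw [map_zero]
  smul_mem' := by
    intro t a ha b
    constructor
    · rw [map_smul, LinearMap.smul_apply, (ha b).1, smul_zero]
    · rw [map_smul, (ha b).2, smul_zero]

/-- `μ` has a square-zero (two-sided) ideal of codimension `1`. -/
def hasSqZeroIdealCodim1 {n : ℕ} (μ : AlgStr k n) : Prop :=
  ∃ I : Submodule k (Fin n → k), Module.finrank k ↥I = n - 1 ∧
    (∀ x ∈ I, ∀ y : Fin n → k, μ x y ∈ I ∧ μ y x ∈ I) ∧
    ∀ x ∈ I, ∀ y ∈ I, μ x y = 0

/-- `a` (viewed as the sequence of parts `a 0 ≥ a 1 ≥ …`) is a partition of `N`. -/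
def IsPartitionOf (a : ℕ → ℕ) (N : ℕ) : Prop :=
  (∀ i j : ℕ, i ≤ j → a j ≤ a i) ∧
    ∃ l : ℕ, (∀ i, l ≤ i → a i = 0) ∧ ∑ i ∈ Finset.range l, a i = N

/-- The dominance order on partitions: `a ⪰ b`. -/
def Dominates (a b : ℕ → ℕ) : Prop :=
  ∀ m : ℕ, ∑ i ∈ Finset.range m, b i ≤ ∑ i ∈ Finset.range m, a i

/-- `a` is the Jordan type of the matrix `M` at the eigenvalue `lam`:
`a` is a partition of the generalized eigenspace dimension, and the parts of `a`
are the sizes of the Jordan blocks of `M` with eigenvalue `lam`, expressed via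
the ranks of powers of `M - lam • 1`. -/
def IsJordanTypeAt {N : ℕ} (M : Matrix (Fin N) (Fin N) k) (lam : k) (a : ℕ → ℕ) :
    Prop :=
  IsPartitionOf a (N - ((M - lam • (1 : Matrix (Fin N) (Fin N) k)) ^ N).rank) ∧
    ∀ p : ℕ, ((M - lam • (1 : Matrix (Fin N) (Fin N) k)) ^ p).rank =
      N - ∑ i ∈ Finset.range N, min (a i) p

/-- The full specter of `M` is `{(lam i, a i)}`: the `lam i` are pairwise distinct,
each `a i` is the (nonempty) Jordan type of `M` at `lam i`, and every eigenvalue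
of `M` occurs among the `lam i`. -/
def IsFullSpecter {N : ℕ} (M : Matrix (Fin N) (Fin N) k) {l : ℕ}
    (lam : Fin l → k) (a : Fin l → ℕ → ℕ) : Prop :=
  Function.Injective lam ∧
    (∀ i, IsJordanTypeAt M (lam i) (a i) ∧ a i 0 ≠ 0) ∧
    ∀ c : k, (∃ v : Fin N → k, v ≠ 0 ∧ M.mulVec v = c • v) → ∃ i, lam i = c

/-- There is a chain of `len` strict dominance steps of partitions of `N`
starting (on top) at `a`. -/
def partChain (a : ℕ → ℕ) (N len : ℕ) : Prop :=
  ∃ c : ℕ → ℕ → ℕ, (∀ i ≤ len, IsPartitionOf (c i) N) ∧ c len = a ∧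
    ∀ i < len, Dominates (c (i + 1)) (c i) ∧ c (i + 1) ≠ c i

/-- The structure `T_α^M ∈ A_{m+1}`. -/
def Tstr {m : ℕ} (α : k) (M : Matrix (Fin m) (Fin m) k) : AlgStr k (m + 1) :=
  ofConst fun i j mm =>
    if hi : i = 0 then
      if hj : j = 0 then (if mm = 0 then α else 0)
      else if hmm : mm = 0 then 0 else M (mm.pred hmm) (j.pred hj)
    else if hj : j = 0 then
      if hmm : mm = 0 then 0 else (if i = mm then α else 0) - M (mm.pred hmm) (i.pred hi)
    else 0

/-- The trivial singular extension `k^{n-2} ⋊_{(L₁,R₁,L₂,R₂)} χ` of the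
`2`-dimensional algebra `χ` given by the coefficients `c11, c12, c21, d12, d21, d22`
(with `χ(e₁,e₁) = c11·e₁ + e₂`, `χ(e₁,e₂) = c12·e₁ + d12·e₂`,
`χ(e₂,e₁) = c21·e₁ + d21·e₂`, `χ(e₂,e₂) = d22·e₂`). -/
def sdExt {m : ℕ} (c11 c12 c21 d12 d21 d22 : k)
    (L1 R1 L2 R2 : Matrix (Fin m) (Fin m) k) : AlgStr k (m + 2) :=
  ofConst fun i j mm =>
    if hi0 : (i : ℕ) = 0 then
      if hj0 : (j : ℕ) = 0 then
        if (mm : ℕ) = 0 then c11 else if (mm : ℕ) = 1 then 1 else 0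
      else if hj1 : (j : ℕ) = 1 then
        if (mm : ℕ) = 0 then c12 else if (mm : ℕ) = 1 then d12 else 0
      else if hmm : (mm : ℕ) < 2 then 0
      else L1 ⟨(mm : ℕ) - 2, by have := mm.isLt; omega⟩
             ⟨(j : ℕ) - 2, by have := j.isLt; omega⟩
    else if hi1 : (i : ℕ) = 1 then
      if hj0 : (j : ℕ) = 0 then
        if (mm : ℕ) = 0 then c21 else if (mm : ℕ) = 1 then d21 else 0
      else if hj1 : (j : ℕ) = 1 then
        if (mm : ℕ) = 1 then d22 else 0
      else if hmm : (mm : ℕ) < 2 then 0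
      else L2 ⟨(mm : ℕ) - 2, by have := mm.isLt; omega⟩
             ⟨(j : ℕ) - 2, by have := j.isLt; omega⟩
    else
      if hj0 : (j : ℕ) = 0 then
        if hmm : (mm : ℕ) < 2 then 0
        else R1 ⟨(mm : ℕ) - 2, by have := mm.isLt; omega⟩
               ⟨(i : ℕ) - 2, by have := i.isLt; omega⟩
      else if hj1 : (j : ℕ) = 1 then
        if hmm : (mm : ℕ) < 2 then 0
        else R2 ⟨(mm : ℕ) - 2, by have := mm.isLt; omega⟩
               ⟨(i : ℕ) - 2, by have := i.isLt; omega⟩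
      else 0

/-! Concrete algebra structures, given by multiplication tables on the standard
basis `e₁, …, eₙ` (0-indexed as `0, …, n-1`); all unspecified products are zero. -/

/-- `A₃ ⊕ k^{n-2}`: `e₁e₁ = e₂`. -/
def A3str (n : ℕ) : AlgStr k n :=
  ofConst fun i j m => if (i : ℕ) = 0 ∧ (j : ℕ) = 0 ∧ (m : ℕ) = 1 then 1 else 0

/-- `n₃ ⊕ k^{n-3}`: `e₁e₂ = e₃`, `e₂e₁ = -e₃`. -/
def n3str (n : ℕ) : AlgStr k n :=
  ofConst fun i j m =>
    if (i : ℕ) = 0 ∧ (j : ℕ) = 1 ∧ (m : ℕ) = 2 then 1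
    else if (i : ℕ) = 1 ∧ (j : ℕ) = 0 ∧ (m : ℕ) = 2 then -1
    else 0

/-- `p⁻`: `e₁eᵢ = eᵢ`, `eᵢe₁ = -eᵢ` for `i ≥ 2`. -/
def pminusStr (n : ℕ) : AlgStr k n :=
  ofConst fun i j m =>
    if (i : ℕ) = 0 ∧ 1 ≤ (j : ℕ) ∧ m = j then 1
    else if 1 ≤ (i : ℕ) ∧ (j : ℕ) = 0 ∧ m = i then -1
    else 0

/-- `ν^α`: `e₁e₁ = e₁`, `e₁eᵢ = α eᵢ`, `eᵢe₁ = (1-α) eᵢ` for `i ≥ 2`. -/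
def nuStr (n : ℕ) (α : k) : AlgStr k n :=
  ofConst fun i j m =>
    if (i : ℕ) = 0 then
      if (j : ℕ) = 0 then (if (m : ℕ) = 0 then 1 else 0)
      else (if m = j then α else 0)
    else if (j : ℕ) = 0 then (if m = i then 1 - α else 0)
    else 0

/-- `k^{n-2} ⋊ E₄`: `e₁e₁ = e₁`, `e₁e₂ = e₁ + e₂`, `e₂e₂ = e₂`,
`e₁eᵢ = eᵢ`, `eᵢe₂ = eᵢ` for `i ≥ 3`.  (For `n = 2` this is `E₄`.) -/
def kE4str (n : ℕ) : AlgStr k n :=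
  ofConst fun i j m =>
    if (i : ℕ) = 0 ∧ (j : ℕ) = 0 then (if (m : ℕ) = 0 then 1 else 0)
    else if (i : ℕ) = 0 ∧ (j : ℕ) = 1 then (if (m : ℕ) = 0 ∨ (m : ℕ) = 1 then 1 else 0)
    else if (i : ℕ) = 1 ∧ (j : ℕ) = 1 then (if (m : ℕ) = 1 then 1 else 0)
    else if (i : ℕ) = 0 ∧ 2 ≤ (j : ℕ) then (if m = j then 1 else 0)
    else if 2 ≤ (i : ℕ) ∧ (j : ℕ) = 1 then (if m = i then 1 else 0)
    else 0

/-- `T₀^{2,(α,β)}`: `e₁e₂ = αe₂ + e₃`, `e₂e₁ = -αe₂ - e₃`,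
`e₁eᵢ = βeᵢ`, `eᵢe₁ = -βeᵢ` for `i ≥ 3`. -/
def T02str (n : ℕ) (α β : k) : AlgStr k n :=
  ofConst fun i j m =>
    if (i : ℕ) = 0 ∧ (j : ℕ) = 1 then
      (if (m : ℕ) = 1 then α else if (m : ℕ) = 2 then 1 else 0)
    else if (i : ℕ) = 1 ∧ (j : ℕ) = 0 then
      (if (m : ℕ) = 1 then -α else if (m : ℕ) = 2 then -1 else 0)
    else if (i : ℕ) = 0 ∧ 2 ≤ (j : ℕ) then (if m = j then β else 0)
    else if 2 ≤ (i : ℕ) ∧ (j : ℕ) = 0 then (if m = i then -β else 0)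
    else 0

/-- `T₁^{2,(α,β)}`: `e₁e₁ = e₁`, `e₁e₂ = αe₂ + e₃`, `e₂e₁ = (1-α)e₂ - e₃`,
`e₁eᵢ = βeᵢ`, `eᵢe₁ = (1-β)eᵢ` for `i ≥ 3`. -/
def T12str (n : ℕ) (α β : k) : AlgStr k n :=
  ofConst fun i j m =>
    if (i : ℕ) = 0 ∧ (j : ℕ) = 0 then (if (m : ℕ) = 0 then 1 else 0)
    else if (i : ℕ) = 0 ∧ (j : ℕ) = 1 then
      (if (m : ℕ) = 1 then α else if (m : ℕ) = 2 then 1 else 0)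
    else if (i : ℕ) = 1 ∧ (j : ℕ) = 0 then
      (if (m : ℕ) = 1 then 1 - α else if (m : ℕ) = 2 then -1 else 0)
    else if (i : ℕ) = 0 ∧ 2 ≤ (j : ℕ) then (if m = j then β else 0)
    else if 2 ≤ (i : ℕ) ∧ (j : ℕ) = 0 then (if m = i then 1 - β else 0)
    else 0

/-- `T₀³`: `e₁e₂ = e₃`, `e₂e₁ = -e₃`, `e₁e₃ = e₄`, `e₃e₁ = -e₄`. -/
def T03str (n : ℕ) : AlgStr k n :=
  ofConst fun i j m =>
    if (i : ℕ) = 0 ∧ (j : ℕ) = 1 ∧ (m : ℕ) = 2 then 1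
    else if (i : ℕ) = 1 ∧ (j : ℕ) = 0 ∧ (m : ℕ) = 2 then -1
    else if (i : ℕ) = 0 ∧ (j : ℕ) = 2 ∧ (m : ℕ) = 3 then 1
    else if (i : ℕ) = 2 ∧ (j : ℕ) = 0 ∧ (m : ℕ) = 3 then -1
    else 0

/-- `T₀^{2,2}`: `e₁e₂ = e₃`, `e₂e₁ = -e₃`, `e₁e₄ = e₅`, `e₄e₁ = -e₅`. -/
def T022str (n : ℕ) : AlgStr k n :=
  ofConst fun i j m =>
    if (i : ℕ) = 0 ∧ (j : ℕ) = 1 ∧ (m : ℕ) = 2 then 1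
    else if (i : ℕ) = 1 ∧ (j : ℕ) = 0 ∧ (m : ℕ) = 2 then -1
    else if (i : ℕ) = 0 ∧ (j : ℕ) = 3 ∧ (m : ℕ) = 4 then 1
    else if (i : ℕ) = 3 ∧ (j : ℕ) = 0 ∧ (m : ℕ) = 4 then -1
    else 0

/-- `η_l ⊕ k^{n-2l-1}`: `e_{2i-1}e_{2i} = e_{2l+1}`, `e_{2i}e_{2i-1} = -e_{2l+1}`
for `1 ≤ i ≤ l`. -/
def etaStr (n l : ℕ) : AlgStr k n :=
  ofConst fun i j m =>
    if (i : ℕ) % 2 = 0 ∧ (j : ℕ) = (i : ℕ) + 1 ∧ (i : ℕ) < 2 * l ∧ (m : ℕ) = 2 * l then 1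
    else if (j : ℕ) % 2 = 0 ∧ (i : ℕ) = (j : ℕ) + 1 ∧ (j : ℕ) < 2 * l ∧ (m : ℕ) = 2 * l then -1
    else 0

/-- `F^{α,β} ⊕ k^{n-3}`: `e₁e₁ = e₃`, `e₁e₂ = αe₃`, `e₂e₁ = βe₃`. -/
def FabStr (n : ℕ) (α β : k) : AlgStr k n :=
  ofConst fun i j m =>
    if (i : ℕ) = 0 ∧ (j : ℕ) = 0 ∧ (m : ℕ) = 2 then 1
    else if (i : ℕ) = 0 ∧ (j : ℕ) = 1 ∧ (m : ℕ) = 2 then α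
    else if (i : ℕ) = 1 ∧ (j : ℕ) = 0 ∧ (m : ℕ) = 2 then β
    else 0

/-- `k^{n-2} ⋊ A₃`: `e₁e₁ = e₂`, `e₁eᵢ = eᵢ`, `eᵢe₁ = -eᵢ` for `i ≥ 3`. -/
def kA3str (n : ℕ) : AlgStr k n :=
  ofConst fun i j m =>
    if (i : ℕ) = 0 ∧ (j : ℕ) = 0 ∧ (m : ℕ) = 1 then 1
    else if (i : ℕ) = 0 ∧ 2 ≤ (j : ℕ) then (if m = j then 1 else 0)
    else if 2 ≤ (i : ℕ) ∧ (j : ℕ) = 0 then (if m = i then -1 else 0)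
    else 0

/-- `k² ⋊_{α,β} A₃ ⊕ k^{n-4}`: `e₁e₁ = e₂`, `e₁e₃ = αe₄`, `e₃e₁ = βe₄`. -/
def k2A3str (n : ℕ) (α β : k) : AlgStr k n :=
  ofConst fun i j m =>
    if (i : ℕ) = 0 ∧ (j : ℕ) = 0 ∧ (m : ℕ) = 1 then 1
    else if (i : ℕ) = 0 ∧ (j : ℕ) = 2 ∧ (m : ℕ) = 3 then α
    else if (i : ℕ) = 2 ∧ (j : ℕ) = 0 ∧ (m : ℕ) = 3 then β
    else 0

/-- `k^{n-2} ⋊_α A₁^α`: `e₁e₁ = e₁ + e₂`, `e₁eᵢ = αeᵢ`, `eᵢe₁ = (1-α)eᵢ` for `i ≥ 2`. -/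
def kA1str (n : ℕ) (α : k) : AlgStr k n :=
  ofConst fun i j m =>
    if (i : ℕ) = 0 ∧ (j : ℕ) = 0 then (if (m : ℕ) = 0 ∨ (m : ℕ) = 1 then 1 else 0)
    else if (i : ℕ) = 0 then (if m = j then α else 0)
    else if (j : ℕ) = 0 then (if m = i then 1 - α else 0)
    else 0

/-- `k^{n-2} ⋊₁ A₂`: `e₁e₁ = e₂`, `e₁eᵢ = eᵢ`, `eᵢe₁ = -eᵢ` for `i ≥ 2`. -/
def kA2str (n : ℕ) : AlgStr k n :=
  ofConst fun i j m =>
    if (i : ℕ) = 0 ∧ (j : ℕ) = 0 then (if (m : ℕ) = 1 then 1 else 0)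
    else if (i : ℕ) = 0 then (if m = j then 1 else 0)
    else if (j : ℕ) = 0 then (if m = i then -1 else 0)
    else 0

/-- `k^{n-2} ⋊₀ᵗ B₂^α`: `e₁eᵢ = αeᵢ`, `eᵢe₁ = (1-α)eᵢ` for `i ≥ 2`. -/
def ktB2str (n : ℕ) (α : k) : AlgStr k n :=
  ofConst fun i j m =>
    if (i : ℕ) = 0 ∧ 1 ≤ (j : ℕ) then (if m = j then α else 0)
    else if 1 ≤ (i : ℕ) ∧ (j : ℕ) = 0 then (if m = i then 1 - α else 0)
    else 0

/-- `k^{n-2} ⋊₀ᵗ D₂^{α,β}`: `e₁e₁ = e₁`, `e₁eᵢ = αeᵢ`, `eᵢe₁ = βeᵢ` for `i ≥ 2`. -/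
def ktD2str (n : ℕ) (α β : k) : AlgStr k n :=
  ofConst fun i j m =>
    if (i : ℕ) = 0 ∧ (j : ℕ) = 0 then (if (m : ℕ) = 0 then 1 else 0)
    else if (i : ℕ) = 0 then (if m = j then α else 0)
    else if (j : ℕ) = 0 then (if m = i then β else 0)
    else 0



/-! ### Polynomial functions of the structure constants and Zariski closures -/

/-- A function on algebra structures that is polynomial in the structure constants. -/
def IsPolyFun {n : ℕ} (F : AlgStr k n → k) : Prop :=
  ∃ p : MvPolynomial (Fin n × Fin n × Fin n) k,
    ∀ μ, F μ = MvPolynomial.eval (structConst μ) p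

theorem apply_eq_sum_structConst {n : ℕ} (μ : AlgStr k n) (x y : Fin n → k) (r : Fin n) :
    μ x y r = ∑ i, ∑ j, x i * y j * structConst μ (i, j, r) := by
  have hx : ∀ x : Fin n → k, x = ∑ i, x i • Pi.single i (1 : k) := fun x => by
    simpa using (pi_eq_sum_univ' x)
  conv_lhs => rw [hx x, hx y]
  simp only [structConst, map_sum, LinearMap.sum_apply, map_smul, LinearMap.smul_apply,
    Finset.sum_apply, Pi.smul_apply, smul_eq_mul, Finset.mul_sum]
  rw [Finset.sum_comm]
  simp only [mul_assoc, mul_left_comm]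

theorem AlgStr.ext_single {n : ℕ} {μ χ : AlgStr k n}
    (h : ∀ i j, μ (Pi.single i 1) (Pi.single j 1) = χ (Pi.single i 1) (Pi.single j 1)) :
    μ = χ := by
  refine (Pi.basisFun k (Fin n)).ext fun i => (Pi.basisFun k (Fin n)).ext fun j => ?_
  simpa using h i j

theorem ofConst_apply {n : ℕ} (c : Fin n → Fin n → Fin n → k) (x y : Fin n → k) :
    ofConst c x y = ∑ i, ∑ j, (x i * y j) • c i j := by
  simp [ofConst, LinearMap.sum_apply]

theorem ofConst_single {n : ℕ} (c : Fin n → Fin n → Fin n → k) (i j : Fin n) :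
    ofConst c (Pi.single i 1) (Pi.single j 1) = c i j := by
  rw [ofConst_apply, Finset.sum_eq_single i, Finset.sum_eq_single j]
  · simp
  · intro b _ hb; simp [hb]
  · simp
  · intro b _ hb; simp [hb]
  · simp

namespace IsPolyFun

variable {n : ℕ} {F G : AlgStr k n → k}

theorem const (c : k) : IsPolyFun (n := n) fun _ => c :=
  ⟨MvPolynomial.C c, by simp⟩

theorem add (hF : IsPolyFun F) (hG : IsPolyFun G) : IsPolyFun fun μ => F μ + G μ := by
  obtain ⟨p, hp⟩ := hF
  obtain ⟨q, hq⟩ := hG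
  exact ⟨p + q, by simp [hp, hq]⟩

theorem sub (hF : IsPolyFun F) (hG : IsPolyFun G) : IsPolyFun fun μ => F μ - G μ := by
  obtain ⟨p, hp⟩ := hF
  obtain ⟨q, hq⟩ := hG
  exact ⟨p - q, by simp [hp, hq]⟩

theorem mul (hF : IsPolyFun F) (hG : IsPolyFun G) : IsPolyFun fun μ => F μ * G μ := by
  obtain ⟨p, hp⟩ := hF
  obtain ⟨q, hq⟩ := hG
  exact ⟨p * q, by simp [hp, hq]⟩

theorem sum {ι : Type*} (s : Finset ι) {F : ι → AlgStr k n → k} (hF : ∀ i, IsPolyFun (F i)) :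
    IsPolyFun fun μ => ∑ i ∈ s, F i μ := by
  choose p hp using hF
  exact ⟨∑ i ∈ s, p i, by simp [hp]⟩

theorem det {ι : Type*} [Fintype ι] [DecidableEq ι] {M : AlgStr k n → Matrix ι ι k}
    (hM : ∀ i j, IsPolyFun fun μ => M μ i j) : IsPolyFun fun μ => (M μ).det := by
  choose p hp using hM
  refine ⟨(Matrix.of p).det, fun μ => ?_⟩
  rw [RingHom.map_det]
  refine congrArg Matrix.det (Matrix.ext fun i j => ?_)
  simp [hp]

theorem apply (x y : Fin n → k) (r : Fin n) : IsPolyFun fun μ : AlgStr k n => μ x y r := by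
  simp_rw [apply_eq_sum_structConst]
  refine sum _ fun i => sum _ fun j => (const _).mul ⟨MvPolynomial.X (i, j, r), by simp⟩

theorem apply_apply (x y w : Fin n → k) (r : Fin n) :
    IsPolyFun fun μ : AlgStr k n => μ (μ x y) w r := by
  have h : (fun μ : AlgStr k n => μ (μ x y) w r) =
      fun μ => ∑ i, μ x y i * μ (Pi.single i 1) w r := by
    funext μ
    conv_lhs => rw [pi_eq_sum_univ' (μ x y)]
    simp [Finset.sum_apply]
  rw [h]
  exact sum _ fun i => (apply _ _ _).mul (apply _ _ _)

theorem eq_zero_of_mem_zclosure {S : Set (AlgStr k n)} (hF : IsPolyFun F)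
    (hS : ∀ μ ∈ S, F μ = 0) {χ : AlgStr k n} (hχ : χ ∈ zclosure S) : F χ = 0 := by
  obtain ⟨p, hp⟩ := hF
  refine hχ {μ | F μ = 0} ⟨{p}, fun μ => ?_⟩ hS
  simp [hp]

end IsPolyFun

theorem mem_zclosure_of_line [Infinite k] {n : ℕ} {S : Set (AlgStr k n)} (A B : AlgStr k n)
    {D : Polynomial k} (hD : D ≠ 0) (h : ∀ t, D.eval t ≠ 0 → A + t • B ∈ S) :
    A ∈ zclosure S := by
  rintro T ⟨P, hP⟩ hST
  refine (hP A).2 fun p hp => ?_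
  set Q : Polynomial k := MvPolynomial.aeval
    (fun s => Polynomial.C (structConst A s) + Polynomial.X * Polynomial.C (structConst B s)) p
    with hQdef
  have hQ : ∀ t, Q.eval t = MvPolynomial.eval (structConst (A + t • B)) p := fun t => by
    rw [hQdef, MvPolynomial.aeval_def, MvPolynomial.polynomial_eval_eval₂, MvPolynomial.eval]
    have hC : (Polynomial.evalRingHom t).comp (algebraMap k (Polynomial k)) = RingHom.id k :=
      RingHom.ext fun c => by simp
    rw [hC, MvPolynomial.coe_eval₂Hom]
    congr 1
    funext s
    simp [structConst, mul_comm t]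
  have hQD : Q * D = 0 := Polynomial.funext fun t => by
    by_cases ht : D.eval t = 0
    · simp [ht]
    · simp [hQ, (hP _).1 (hST (h t ht)) p hp]
  have := hQ 0
  rw [(mul_eq_zero.1 hQD).resolve_right hD] at this
  simpa using this.symm

/-! ### Orbits -/

theorem transport_apply {n : ℕ} (g : (Fin n → k) ≃ₗ[k] (Fin n → k)) (μ : AlgStr k n)
    (x y : Fin n → k) : transport g μ x y = g (μ (g.symm x) (g.symm y)) := rfl

theorem transport_mem_orbit {n : ℕ} {μ χ : AlgStr k n} (hχ : χ ∈ orbit μ)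
    (g : (Fin n → k) ≃ₗ[k] (Fin n → k)) : transport g χ ∈ orbit μ := by
  obtain ⟨h, rfl⟩ := hχ
  exact ⟨h.trans g, rfl⟩

theorem transport_add_smul {n : ℕ} (g : (Fin n → k) ≃ₗ[k] (Fin n → k)) (A B : AlgStr k n)
    (t : k) : transport g (A + t • B) = transport g A + t • transport g B :=
  LinearMap.ext fun x => LinearMap.ext fun y => by simp [transport_apply]

theorem orbit_subset_zclosure_of_line [Infinite k] {n : ℕ} {μ : AlgStr k n} (A B : AlgStr k n)
    {D : Polynomial k} (hD : D ≠ 0) (h : ∀ t, D.eval t ≠ 0 → A + t • B ∈ orbit μ) :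
    orbit A ⊆ zclosure (orbit μ) := by
  rintro _ ⟨g, rfl⟩
  refine mem_zclosure_of_line _ (transport g B) hD fun t ht => ?_
  rw [← transport_add_smul]
  exact transport_mem_orbit (h t ht) g

theorem mem_orbit_zero {n : ℕ} {μ : AlgStr k n} : μ ∈ orbit (0 : AlgStr k n) ↔ μ = 0 := by
  have h : ∀ g, transport g (0 : AlgStr k n) = 0 := fun g =>
    LinearMap.ext fun x => LinearMap.ext fun y => by simp [transport_apply]
  simp [orbit, h, eq_comm]

theorem mem_orbit_ofConst_iff {n : ℕ} {c : Fin n → Fin n → Fin n → k} {μ : AlgStr k n} :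
    μ ∈ orbit (ofConst c) ↔
      ∃ b : Module.Basis (Fin n) k (Fin n → k), ∀ i j, μ (b i) (b j) = ∑ r, c i j r • b r := by
  constructor
  · rintro ⟨g, rfl⟩
    refine ⟨(Pi.basisFun k (Fin n)).map g, fun i j => ?_⟩
    simp only [Module.Basis.map_apply, Pi.basisFun_apply, transport_apply,
      LinearEquiv.symm_apply_apply, ofConst_single, ← map_smul, ← map_sum]
    rw [← pi_eq_sum_univ']
  · rintro ⟨b, hb⟩
    refine ⟨b.equivFun.symm, b.ext fun i => b.ext fun j => ?_⟩
    have e : ∀ i, b.equivFun.symm.symm (b i) = Pi.single i 1 := fun i => by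
      funext j
      rw [LinearEquiv.symm_symm, Module.Basis.equivFun_self]
      simp [Pi.single_apply, eq_comm]
    rw [transport_apply, e, e, ofConst_single, hb, Module.Basis.equivFun_symm_apply]

/-- A linearly independent family extends to a basis. -/
theorem LinearIndependent.exists_basis_sum {V : Type*} [AddCommGroup V] [Module k V]
    [FiniteDimensional k V] {s : ℕ} {v : Fin s → V} (hv : LinearIndependent k v) :
    ∃ (d : ℕ) (b : Module.Basis (Fin s ⊕ Fin d) k V), ∀ i, b (Sum.inl i) = v i := by
  obtain ⟨W, hW⟩ := Submodule.exists_isCompl (Submodule.span k (Set.range v))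
  let c := Module.finBasis k W
  have hc : Submodule.span k (Set.range fun i => (c i : V)) = W := by
    have := congrArg (Submodule.map W.subtype) c.span_eq
    rw [Submodule.map_span, ← Set.range_comp, Submodule.map_subtype_top] at this
    exact this
  have hli : LinearIndependent k (Sum.elim v fun i => (c i : V)) := by
    refine hv.sum_type (c.linearIndependent.map' W.subtype W.ker_subtype) ?_
    simpa [hc] using hW.disjoint
  refine ⟨_, Module.Basis.mk hli ?_, fun i => by rw [Module.Basis.mk_apply, Sum.elim_inl]⟩
  rw [Set.Sum.elim_range, Submodule.span_union, hc, hW.sup_eq_top]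

/-! ### The structures `f x • y + g y • x` -/

/-- The algebra structure `(x, y) ↦ f x • y + g y • x`. -/
def pairAlg {n : ℕ} (f g : Module.Dual k (Fin n → k)) : AlgStr k n :=
  LinearMap.mk₂ k (fun x y => f x • y + g y • x)
    (fun x x' y => by simp only [map_add, add_smul, smul_add]; abel)
    (fun c x y => by simp only [map_smul, smul_add, smul_smul, smul_eq_mul, mul_comm])
    (fun x y y' => by simp only [map_add, add_smul, smul_add]; abel)
    (fun c x y => by simp only [map_smul, smul_add, smul_smul, smul_eq_mul, mul_comm])

theorem pairAlg_apply {n : ℕ} (f g : Module.Dual k (Fin n → k)) (x y : Fin n → k) :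
    pairAlg f g x y = f x • y + g y • x := rfl

theorem pairAlg_zero {n : ℕ} : pairAlg (0 : Module.Dual k (Fin n → k)) 0 = 0 :=
  LinearMap.ext fun x => LinearMap.ext fun y => by simp [pairAlg_apply]

theorem pairAlg_add_smul {n : ℕ} (f g f' g' : Module.Dual k (Fin n → k)) (t : k) :
    pairAlg f g + t • pairAlg f' g' = pairAlg (f + t • f') (g + t • g') :=
  LinearMap.ext fun x => LinearMap.ext fun y => by
    simp only [pairAlg_apply, LinearMap.add_apply, LinearMap.smul_apply, smul_add, add_smul,
      smul_eq_mul, mul_smul]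
    abel

theorem transport_pairAlg {n : ℕ} (T : (Fin n → k) ≃ₗ[k] (Fin n → k))
    (f g : Module.Dual k (Fin n → k)) :
    transport T (pairAlg f g) = pairAlg (f ∘ₗ T.symm.toLinearMap) (g ∘ₗ T.symm.toLinearMap) :=
  LinearMap.ext fun x => LinearMap.ext fun y => by simp [transport_apply, pairAlg_apply]

theorem pairAlg_comp_mem_orbit {n : ℕ} (T : (Fin n → k) ≃ₗ[k] (Fin n → k))
    (f g : Module.Dual k (Fin n → k)) :
    pairAlg (f ∘ₗ T.toLinearMap) (g ∘ₗ T.toLinearMap) ∈ orbit (pairAlg f g) :=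
  ⟨T.symm, by rw [transport_pairAlg, LinearEquiv.symm_symm]⟩

theorem exists_pairAlg_of_mem_orbit {n : ℕ} {f g : Module.Dual k (Fin n → k)} {μ : AlgStr k n}
    (h : μ ∈ orbit (pairAlg f g)) : ∃ f' g', μ = pairAlg f' g' := by
  obtain ⟨T, rfl⟩ := h
  exact ⟨_, _, transport_pairAlg T f g⟩

theorem kE4str_eq_pairAlg {n : ℕ} (h0 : 0 < n) (h1 : 1 < n) :
    kE4str (k := k) n = pairAlg (LinearMap.proj ⟨0, h0⟩) (LinearMap.proj ⟨1, h1⟩) := by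
  refine AlgStr.ext_single fun i j => funext fun r => ?_
  rw [kE4str, ofConst_single, pairAlg_apply]
  simp only [LinearMap.proj_apply, Pi.add_apply, Pi.smul_apply, Pi.single_apply, smul_eq_mul,
    Fin.ext_iff]
  split_ifs <;> first | omega | simp

theorem pminusStr_eq_pairAlg {n : ℕ} (h0 : 0 < n) :
    pminusStr (k := k) n = pairAlg (LinearMap.proj ⟨0, h0⟩) (-LinearMap.proj ⟨0, h0⟩) := by
  refine AlgStr.ext_single fun i j => funext fun r => ?_
  rw [pminusStr, ofConst_single, pairAlg_apply]
  simp only [LinearMap.proj_apply, Pi.add_apply, Pi.smul_apply, Pi.single_apply, smul_eq_mul,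
    Fin.ext_iff, LinearMap.neg_apply]
  split_ifs <;> first | omega | simp

theorem nuStr_eq_pairAlg {n : ℕ} (h0 : 0 < n) (α : k) :
    nuStr n α = pairAlg (α • LinearMap.proj ⟨0, h0⟩) ((1 - α) • LinearMap.proj ⟨0, h0⟩) := by
  refine AlgStr.ext_single fun i j => funext fun r => ?_
  rw [nuStr, ofConst_single, pairAlg_apply]
  simp only [LinearMap.proj_apply, Pi.add_apply, Pi.smul_apply, Pi.single_apply, smul_eq_mul,
    Fin.ext_iff, LinearMap.smul_apply]
  split_ifs <;> first | omega | simp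

/-- Linearly independent functionals become coordinate functionals after a change of basis. -/
theorem exists_linearEquiv_proj_comp {n s : ℕ} {v : Fin s → Module.Dual k (Fin n → k)}
    (hv : LinearIndependent k v) :
    ∃ T : (Fin n → k) ≃ₗ[k] (Fin n → k), ∀ (i : Fin s) (hi : (i : ℕ) < n),
      LinearMap.proj ⟨i, hi⟩ ∘ₗ T.toLinearMap = v i := by
  obtain ⟨d, b, hb⟩ := hv.exists_basis_sum
  obtain rfl : n = s + d := by
    have := Module.finrank_eq_card_basis b
    rw [Subspace.dual_finrank_eq] at this
    simpa using this
  let φ : (Fin (s + d) → k) →ₗ[k] (Fin (s + d) → k) :=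
    LinearMap.pi fun i => b (finSumFinEquiv.symm i)
  have hφ : Function.Injective φ := by
    rw [← LinearMap.ker_eq_bot, LinearMap.ker_eq_bot']
    intro x hx
    refine (Module.forall_dual_apply_eq_zero_iff k x).1 fun f => ?_
    have : LinearMap.applyₗ (R := k) x = (0 : Module.Dual k (Fin (s + d) → k) →ₗ[k] k) :=
      b.ext fun i => by simpa [φ] using congrFun hx (finSumFinEquiv i)
    exact LinearMap.congr_fun this f
  refine ⟨LinearEquiv.ofInjectiveEndo φ hφ, fun i hi => LinearMap.ext fun x => ?_⟩
  have : (⟨i, hi⟩ : Fin (s + d)) = finSumFinEquiv (Sum.inl i) := rfl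
  simp [this, φ, hb]

theorem pairAlg_mem_orbit_kE4str {n : ℕ} (hn : 2 ≤ n) {f g : Module.Dual k (Fin n → k)}
    (h : LinearIndependent k ![f, g]) : pairAlg f g ∈ orbit (kE4str (k := k) n) := by
  obtain ⟨T, hT⟩ := exists_linearEquiv_proj_comp h
  have h0 := hT 0 (by simp; omega)
  have h1 := hT 1 (by simp; omega)
  rw [kE4str_eq_pairAlg (by omega) (by omega)]
  have := pairAlg_comp_mem_orbit T (LinearMap.proj ⟨0, by omega⟩) (LinearMap.proj ⟨1, by omega⟩)
  convert this using 2
  · exact h0.symm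
  · exact h1.symm

theorem pairAlg_smul_mem_orbit {n : ℕ} (hn : 0 < n) (a b : k) {f : Module.Dual k (Fin n → k)}
    (hf : f ≠ 0) : pairAlg (a • f) (b • f) ∈
      orbit (pairAlg (a • LinearMap.proj ⟨0, hn⟩) (b • LinearMap.proj ⟨0, hn⟩)) := by
  obtain ⟨T, hT⟩ := exists_linearEquiv_proj_comp (v := ![f]) (by simpa using hf)
  have h0 : LinearMap.proj ⟨0, hn⟩ ∘ₗ T.toLinearMap = f := hT 0 hn
  have := pairAlg_comp_mem_orbit T (a • LinearMap.proj ⟨0, hn⟩) (b • LinearMap.proj ⟨0, hn⟩)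
  rwa [LinearMap.smul_comp, LinearMap.smul_comp, h0] at this

theorem pairAlg_mem_union {n : ℕ} (hn : 2 ≤ n) (f g : Module.Dual k (Fin n → k)) :
    pairAlg f g ∈ orbit (kE4str n) ∪ orbit (pminusStr n) ∪ orbit (0 : AlgStr k n) ∪
      ⋃ α : k, orbit (nuStr n α) := by
  have hn0 : 0 < n := by omega
  have key : ∀ (a b : k) (h : Module.Dual k (Fin n → k)), h ≠ 0 → (a ≠ 0 ∨ b ≠ 0) →
      pairAlg (a • h) (b • h) ∈ orbit (pminusStr n) ∪ ⋃ α : k, orbit (nuStr n α) := by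
    intro a b h hh hab
    by_cases hs : a + b = 0
    · left
      obtain rfl : b = -a := (neg_eq_of_add_eq_zero_right hs).symm
      have ha : a ≠ 0 := by simpa using hab
      have := pairAlg_smul_mem_orbit hn0 1 (-1) (smul_ne_zero ha hh)
      rw [pminusStr_eq_pairAlg hn0]
      have hneg : ∀ f : Module.Dual k (Fin n → k), (-1 : k) • f = -f := fun f =>
        LinearMap.ext fun x => by simp
      rwa [one_smul, one_smul, hneg, hneg, ← neg_smul] at this
    · right
      have := pairAlg_smul_mem_orbit hn0 (a / (a + b)) (1 - a / (a + b)) (smul_ne_zero hs hh)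
      rw [← nuStr_eq_pairAlg, smul_smul, smul_smul, div_mul_cancel₀ _ hs, sub_mul,
        div_mul_cancel₀ _ hs, one_mul, add_sub_cancel_left] at this
      exact Set.mem_iUnion.2 ⟨_, this⟩
  by_cases hli : LinearIndependent k ![f, g]
  · exact .inl (.inl (.inl (pairAlg_mem_orbit_kE4str hn hli)))
  by_cases hf : f = 0
  · by_cases hg : g = 0
    · subst hf hg
      exact .inl (.inr (mem_orbit_zero.2 pairAlg_zero))
    · have := key 0 1 g hg (by simp)
      rw [zero_smul, one_smul, ← hf] at this
      rcases this with h | h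
      · exact .inl (.inl (.inr h))
      · exact .inr h
  · rw [LinearIndependent.pair_iff' hf] at hli
    push Not at hli
    obtain ⟨a, rfl⟩ := hli
    have := key 1 a f hf (by simp)
    rw [one_smul] at this
    rcases this with h | h
    · exact .inl (.inl (.inr h))
    · exact .inr h

theorem pairAlg_mem_zclosure [Infinite k] {n : ℕ} (hn : 2 ≤ n)
    (f g : Module.Dual k (Fin n → k)) :
    pairAlg f g ∈ zclosure (orbit (kE4str (k := k) n)) := by
  let i : Fin n := ⟨0, by omega⟩
  let j : Fin n := ⟨1, by omega⟩
  have hij : i ≠ j := by simp [i, j]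
  let e : Fin n → Fin n → k := fun i => Pi.single i 1
  open Polynomial in
  let D : k[X] := X ^ 2 + C (f (e i) + g (e j)) * X + C (f (e i) * g (e j) - f (e j) * g (e i))
  have hD : D ≠ 0 := fun h => by
    simpa [D, Polynomial.coeff_X, Polynomial.coeff_C, -map_add, -map_sub] using
      congrArg (Polynomial.coeff · 2) h
  refine mem_zclosure_of_line _ (pairAlg (LinearMap.proj i) (LinearMap.proj j)) hD fun t ht => ?_
  rw [pairAlg_add_smul]
  refine pairAlg_mem_orbit_kE4str hn (LinearIndependent.pair_iff.2 fun a b hab => ?_)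
  have hi := LinearMap.congr_fun hab (e i)
  have hj := LinearMap.congr_fun hab (e j)
  simp only [LinearMap.add_apply, LinearMap.smul_apply, LinearMap.proj_apply, smul_eq_mul,
    LinearMap.zero_apply, e, Pi.single_eq_same, Pi.single_eq_of_ne hij, Pi.single_eq_of_ne hij.symm,
    mul_one, mul_zero, add_zero] at hi hj
  simp only [D, e, Polynomial.eval_add, Polynomial.eval_mul, Polynomial.eval_pow,
    Polynomial.eval_X, Polynomial.eval_C] at ht
  constructor
  · refine (mul_eq_zero.1 ?_).resolve_right ht
    linear_combination (g (Pi.single j 1) + t) * hi - g (Pi.single i 1) * hj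
  · refine (mul_eq_zero.1 ?_).resolve_right ht
    linear_combination (f (Pi.single i 1) + t) * hj - f (Pi.single j 1) * hi

theorem exists_pairAlg_of_mem_zclosure {n : ℕ} (hn : 2 ≤ n) {χ : AlgStr k n}
    (hχ : χ ∈ zclosure (orbit (kE4str (k := k) n))) : ∃ f g, χ = pairAlg f g := by
  have : Nontrivial (Fin n) := Fin.nontrivial_iff_two_le.2 hn
  choose σ hσ using fun i : Fin n => exists_ne i
  let e : Fin n → Fin n → k := fun i => Pi.single i 1
  have hF : ∀ x y r, χ x y r =
      (∑ i, x i * χ (e i) (e (σ i)) (σ i)) * y r + (∑ i, y i * χ (e (σ i)) (e i) (σ i)) * x r := by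
    intro x y r
    have hp : IsPolyFun fun μ : AlgStr k n => μ x y r -
      ((∑ i, x i * μ (e i) (e (σ i)) (σ i)) * y r +
        (∑ i, y i * μ (e (σ i)) (e i) (σ i)) * x r) :=
      (IsPolyFun.apply _ _ _).sub <| .add
        (.mul (.sum _ fun i => (IsPolyFun.const _).mul (.apply _ _ _)) (.const _))
        (.mul (.sum _ fun i => (IsPolyFun.const _).mul (.apply _ _ _)) (.const _))
    refine sub_eq_zero.1 (hp.eq_zero_of_mem_zclosure (fun μ hμ => ?_) hχ)
    rw [kE4str_eq_pairAlg (by omega) (by omega)] at hμ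
    obtain ⟨f, g, rfl⟩ := exists_pairAlg_of_mem_orbit hμ
    have hsum : ∀ (f : Module.Dual k (Fin n → k)) (x : Fin n → k), ∑ i, x i * f (e i) = f x :=
      fun f x => by conv_rhs => rw [pi_eq_sum_univ' x]
                    simp [e]
    simp [pairAlg_apply, e, hσ]
    rw [hsum, hsum]
    ring
  refine ⟨∑ i, χ (e i) (e (σ i)) (σ i) • LinearMap.proj i,
    ∑ i, χ (e (σ i)) (e i) (σ i) • LinearMap.proj i, ?_⟩
  refine LinearMap.ext fun x => LinearMap.ext fun y => funext fun r => ?_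
  rw [hF, pairAlg_apply]
  simp [LinearMap.sum_apply, mul_comm]

theorem zclosure_orbit_kE4str [Infinite k] {n : ℕ} (hn : 2 ≤ n) :
    zclosure (orbit (kE4str (k := k) n)) =
      orbit (kE4str n) ∪ orbit (pminusStr n) ∪ orbit (0 : AlgStr k n) ∪
        ⋃ α : k, orbit (nuStr n α) := by
  have hn0 : 0 < n := by omega
  refine Set.Subset.antisymm (fun χ hχ => ?_) fun χ hχ => ?_
  · obtain ⟨f, g, rfl⟩ := exists_pairAlg_of_mem_zclosure hn hχ
    exact pairAlg_mem_union hn f g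
  · obtain ⟨f, g, rfl⟩ : ∃ f g, χ = pairAlg f g := by
      rw [kE4str_eq_pairAlg hn0 (by omega), pminusStr_eq_pairAlg hn0, ← pairAlg_zero] at hχ
      simp only [nuStr_eq_pairAlg hn0] at hχ
      rcases hχ with ((h | h) | h) | h
      · exact exists_pairAlg_of_mem_orbit h
      · exact exists_pairAlg_of_mem_orbit h
      · exact exists_pairAlg_of_mem_orbit h
      · obtain ⟨α, h⟩ := Set.mem_iUnion.1 h
        exact exists_pairAlg_of_mem_orbit h
    exact pairAlg_mem_zclosure hn f g

/-! ### Alternating forms and the structures `η_l` -/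

/-- The Gram matrix of a sequence of hyperbolic pairs. -/
def hypGram (k : Type*) [Field k] (i j : ℕ) : k :=
  if i % 2 = 0 ∧ j = i + 1 then 1 else if j % 2 = 0 ∧ i = j + 1 then -1 else 0

/-- The index paired with `i` in a sequence of hyperbolic pairs. -/
def hypPartner (i : ℕ) : ℕ := if i % 2 = 0 then i + 1 else i - 1

theorem hypPartner_lt_iff {i l : ℕ} : hypPartner i < 2 * l ↔ i < 2 * l := by
  unfold hypPartner; split_ifs <;> omega

theorem hypPartner_hypPartner (i : ℕ) : hypPartner (hypPartner i) = i := by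
  unfold hypPartner; split_ifs <;> omega

theorem hypGram_mul_self (i : ℕ) :
    hypGram k i (hypPartner i) * hypGram k i (hypPartner i) = 1 := by
  unfold hypGram hypPartner
  split_ifs <;> first | omega | simp

theorem hypGram_eq_zero {i j : ℕ} (h : j ≠ i) : hypGram k j (hypPartner i) = 0 := by
  unfold hypGram hypPartner
  split_ifs <;> first | omega | rfl

theorem hypGram_self (i : ℕ) : hypGram k i i = 0 := by
  unfold hypGram
  split_ifs <;> first | omega | rfl

theorem hypGram_swap (i j : ℕ) : hypGram k j i = -hypGram k i j := by
  unfold hypGram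
  split_ifs <;> first | omega | simp

/-- The Gram matrix of `l` hyperbolic pairs, extended by zero. -/
def truncGram (k : Type*) [Field k] (l i j : ℕ) : k :=
  if i < 2 * l ∧ j < 2 * l then hypGram k i j else 0

theorem etaStr_eq_ofConst (n l : ℕ) :
    etaStr (k := k) n l =
      ofConst fun i j r => if (r : ℕ) = 2 * l then truncGram k l i j else 0 := by
  unfold etaStr truncGram hypGram
  congr 1
  funext i j r
  split_ifs <;> first | omega | rfl

theorem sum_ite_val_eq_smul {n : ℕ} {V : Type*} [AddCommGroup V] [Module k V] {q : ℕ}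
    (h : q < n) (a : k) (b : Fin n → V) :
    ∑ r : Fin n, (if (r : ℕ) = q then a else 0) • b r = a • b ⟨q, h⟩ := by
  rw [Finset.sum_eq_single ⟨q, h⟩]
  · simp
  · intro r _ hr
    rw [if_neg fun h' => hr (Fin.ext h'), zero_smul]
  · simp

theorem mem_orbit_ofConst_single_iff {n q : ℕ} (h : q < n) {w : Fin n → Fin n → k}
    {μ : AlgStr k n} :
    μ ∈ orbit (ofConst fun i j r => if (r : ℕ) = q then w i j else 0) ↔
      ∃ b : Module.Basis (Fin n) k (Fin n → k), ∀ i j, μ (b i) (b j) = w i j • b ⟨q, h⟩ := by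
  simp only [mem_orbit_ofConst_iff, sum_ite_val_eq_smul h]

theorem mem_orbit_etaStr_iff {n l : ℕ} (h : 2 * l < n) {μ : AlgStr k n} :
    μ ∈ orbit (etaStr n l) ↔ ∃ b : Module.Basis (Fin n) k (Fin n → k),
      ∀ i j, μ (b i) (b j) = truncGram k l i j • b ⟨2 * l, h⟩ := by
  rw [etaStr_eq_ofConst, mem_orbit_ofConst_single_iff h]

theorem etaStr_zero (n : ℕ) : etaStr (k := k) n 0 = 0 := by
  rw [etaStr_eq_ofConst]
  refine AlgStr.ext_single fun i j => ?_
  rw [ofConst_single]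
  funext r
  simp [truncGram]

theorem orbit_etaStr_subset_zclosure [Infinite k] {n m l : ℕ} (hl : l ≤ m) (hm : 2 * m < n) :
    orbit (etaStr (k := k) n l) ⊆ zclosure (orbit (etaStr n m)) := by
  let A : AlgStr k n := ofConst fun i j r => if (r : ℕ) = 2 * m then truncGram k l i j else 0
  let B : AlgStr k n := ofConst fun i j r =>
    if (r : ℕ) = 2 * m then truncGram k m i j - truncGram k l i j else 0
  have hA : etaStr n l ∈ orbit A := by
    rw [mem_orbit_ofConst_single_iff hm]
    have hl' : 2 * l < n := by omega
    let σ : Equiv.Perm (Fin n) := Equiv.swap ⟨2 * l, hl'⟩ ⟨2 * m, hm⟩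
    have hσ : ∀ i : Fin n, (i : ℕ) < 2 * l → σ i = i := fun i hi =>
      Equiv.swap_apply_of_ne_of_ne (by rintro rfl; simp at hi) (by rintro rfl; simp at hi; omega)
    have hσ' : ∀ i : Fin n, ¬ (i : ℕ) < 2 * l → ¬ (σ i : ℕ) < 2 * l := by
      intro i hi hi'
      have := hσ _ hi'
      rw [σ.injective this] at hi'
      exact hi hi'
    refine ⟨(Pi.basisFun k (Fin n)).reindex σ, fun i j => ?_⟩
    have hσs : σ.symm = σ := Equiv.symm_swap _ _
    have hq : σ ⟨2 * m, hm⟩ = ⟨2 * l, hl'⟩ := Equiv.swap_apply_right _ _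
    have hJ : truncGram k l (σ i) (σ j) = truncGram k l i j := by
      by_cases hi : (i : ℕ) < 2 * l
      · by_cases hj : (j : ℕ) < 2 * l
        · rw [hσ i hi, hσ j hj]
        · simp [truncGram, hj, hσ' j hj]
      · simp [truncGram, hi, hσ' i hi]
    rw [etaStr_eq_ofConst]
    simp only [Module.Basis.reindex_apply, Pi.basisFun_apply, ofConst_single, hσs, hq, hJ]
    funext r
    simp [Pi.single_apply, Fin.ext_iff]
  have hAB : orbit A ⊆ zclosure (orbit (etaStr n m)) := by
    refine orbit_subset_zclosure_of_line A B (D := Polynomial.X) Polynomial.X_ne_zero ?_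
    intro t ht
    rw [Polynomial.eval_X] at ht
    rw [mem_orbit_etaStr_iff hm]
    let w : Fin n → kˣ := fun i =>
      if 2 * l ≤ (i : ℕ) ∧ (i : ℕ) < 2 * m ∧ (i : ℕ) % 2 = 1 then (Units.mk0 t ht)⁻¹ else 1
    refine ⟨(Pi.basisFun k (Fin n)).unitsSMul w, fun i j => ?_⟩
    have hw : (w i : k) * w j * (truncGram k l i j + t * (truncGram k m i j - truncGram k l i j))
        = truncGram k m i j := by
      simp only [w, truncGram, hypGram]
      split_ifs <;> first | omega | simp [ht]
    have hwm : w ⟨2 * m, hm⟩ = 1 := by simp [w]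
    simp only [Module.Basis.unitsSMul_apply, Pi.basisFun_apply, hwm, one_smul, Units.smul_def,
      map_smul, LinearMap.smul_apply, LinearMap.add_apply, A, B, ofConst_single]
    funext r
    simp only [Pi.smul_apply, Pi.add_apply, smul_eq_mul, Pi.single_apply, Fin.ext_iff]
    split_ifs
    · linear_combination hw
    · ring
  rintro _ ⟨g, rfl⟩
  exact hAB (transport_mem_orbit hA g)

section AlternatingForm

variable {V : Type*} [AddCommGroup V] [Module k V] {ω : V →ₗ[k] V →ₗ[k] k}

theorem coeff_eq_zero_of_hypGram {l : ℕ} {u : ℕ → V}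
    (hu : ∀ i < 2 * l, ∀ j < 2 * l, ω (u i) (u j) = hypGram k i j) {c : Fin (2 * l) → k}
    (hc : ∀ i < 2 * l, ω (∑ j, c j • u j) (u i) = 0) : c = 0 := by
  funext i
  have h := hc _ (hypPartner_lt_iff.2 i.2)
  simp only [map_sum, LinearMap.sum_apply, map_smul, LinearMap.smul_apply, smul_eq_mul] at h
  rw [Finset.sum_eq_single i] at h
  · rw [hu _ i.2 _ (hypPartner_lt_iff.2 i.2)] at h
    rw [Pi.zero_apply]
    linear_combination h * hypGram k i (hypPartner i) - c i * hypGram_mul_self (k := k) i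
  · intro j _ hj
    rw [hu _ j.2 _ (hypPartner_lt_iff.2 i.2), hypGram_eq_zero (fun h => hj (Fin.ext h)), mul_zero]
  · simp

theorem linearIndependent_of_hypGram {l : ℕ} {u : ℕ → V}
    (hu : ∀ i < 2 * l, ∀ j < 2 * l, ω (u i) (u j) = hypGram k i j) :
    LinearIndependent k fun i : Fin (2 * l) => u i := by
  refine Fintype.linearIndependent_iff.2 fun c hc => congrFun ?_
  exact coeff_eq_zero_of_hypGram hu fun i _ => by rw [hc]; simp

theorem exists_hypGram_succ (hω : ∀ x, ω x x = 0) {l : ℕ} {u : ℕ → V}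
    (hu : ∀ i < 2 * l, ∀ j < 2 * l, ω (u i) (u j) = hypGram k i j) {x y : V}
    (hx : ∀ i < 2 * l, ω x (u i) = 0) (hxy : ω x y ≠ 0) :
    ∃ u : ℕ → V, ∀ i < 2 * (l + 1), ∀ j < 2 * (l + 1), ω (u i) (u j) = hypGram k i j := by
  have hskew : ∀ x y, ω x y = -ω y x := fun x y => by
    have := hω (x + y)
    simp only [map_add, LinearMap.add_apply, hω, zero_add, add_zero] at this
    exact eq_neg_of_add_eq_zero_right this
  let y' := (ω x y)⁻¹ • (y - ∑ j ∈ Finset.range (2 * l),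
    (ω y (u (hypPartner j)) * hypGram k j (hypPartner j)) • u j)
  have hy' : ∀ i < 2 * l, ω y' (u i) = 0 := by
    intro i hi
    have hp := hypPartner_lt_iff.2 hi
    simp only [y', map_smul, map_sub, map_sum, LinearMap.smul_apply, LinearMap.sub_apply,
      LinearMap.sum_apply, smul_eq_mul]
    rw [Finset.sum_eq_single (hypPartner i), hu _ hp _ hi, mul_assoc]
    · have := hypGram_mul_self (k := k) (hypPartner i)
      rw [hypPartner_hypPartner] at this
      rw [hypPartner_hypPartner, this]
      simp
    · intro j hj hji
      rw [hu _ (Finset.mem_range.1 hj) _ hi]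
      have := hypGram_eq_zero (k := k) hji
      rw [hypPartner_hypPartner] at this
      rw [this, mul_zero]
    · intro h
      exact absurd (Finset.mem_range.2 hp) h
  have hxy' : ω x y' = 1 := by
    simp only [y', map_smul, map_sub, map_sum, smul_eq_mul]
    rw [Finset.sum_eq_zero fun j hj => by rw [hx j (Finset.mem_range.1 hj), mul_zero], sub_zero,
      inv_mul_cancel₀ hxy]
  refine ⟨fun i => if i < 2 * l then u i else if i = 2 * l then x else y', ?_⟩
  have key : ∀ i j, i < j → j < 2 * (l + 1) →
      ω (if i < 2 * l then u i else if i = 2 * l then x else y')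
        (if j < 2 * l then u j else if j = 2 * l then x else y') = hypGram k i j := by
    intro i j hij hj
    split_ifs with h1 h2 h3 h4 h5 h6 h7 h8
    · exact hu i h1 j h2
    · rw [hskew, hx i h1, hypGram, if_neg (by omega), if_neg (by omega), neg_zero]
    · rw [hskew, hy' i h1, hypGram, if_neg (by omega), if_neg (by omega), neg_zero]
    all_goals first | omega | (rw [hxy', hypGram, if_pos (by omega)])
  intro i hi j hj
  rcases lt_trichotomy i j with h | rfl | h
  · exact key i j h hj
  · rw [hω, hypGram_self]
  · rw [hskew, key j i h hi, hypGram_swap, neg_neg]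

/-- An alternating form has a maximal system of hyperbolic pairs, whose orthogonal complement is
the radical of the form. -/
theorem exists_hypGram_maximal [FiniteDimensional k V] (hω : ∀ x, ω x x = 0) :
    ∃ (l : ℕ) (u : ℕ → V),
      (∀ i < 2 * l, ∀ j < 2 * l, ω (u i) (u j) = hypGram k i j) ∧
        ∀ x, (∀ i < 2 * l, ω x (u i) = 0) → ∀ y, ω x y = 0 := by
  by_contra! hcon
  have h : ∀ l, ∃ u : ℕ → V, ∀ i < 2 * l, ∀ j < 2 * l, ω (u i) (u j) = hypGram k i j := by
    intro l
    induction l with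
    | zero => exact ⟨0, by simp⟩
    | succ l ih =>
      obtain ⟨u, hu⟩ := ih
      obtain ⟨x, hx, y, hxy⟩ := hcon l u hu
      exact exists_hypGram_succ hω hu hx hxy
  obtain ⟨u, hu⟩ := h (Module.finrank k V + 1)
  have := (linearIndependent_of_hypGram hu).fintype_card_le_finrank
  rw [Fintype.card_fin] at this
  omega

end AlternatingForm

theorem mem_orbit_etaStr_of_hypGram {n l : ℕ} {μ : AlgStr k n}
    {ω : (Fin n → k) →ₗ[k] (Fin n → k) →ₗ[k] k} {z : Fin n → k} (hz : z ≠ 0)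
    (hωz : ∀ y, ω z y = 0) (hω : ∀ x, ω x x = 0) (hμ : ∀ x y, μ x y = ω x y • z)
    {u : ℕ → Fin n → k} (hu : ∀ i < 2 * l, ∀ j < 2 * l, ω (u i) (u j) = hypGram k i j)
    (hrad : ∀ x, (∀ i < 2 * l, ω x (u i) = 0) → ∀ y, ω x y = 0) :
    2 * l < n ∧ μ ∈ orbit (etaStr n l) := by
  have hskew : ∀ x y, ω x y = -ω y x := fun x y => by
    have := hω (x + y)
    simp only [map_add, LinearMap.add_apply, hω, zero_add, add_zero] at this
    exact eq_neg_of_add_eq_zero_right this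
  let φ : (Fin n → k) →ₗ[k] (Fin (2 * l) → k) := LinearMap.pi fun i => ω.flip (u i)
  have hφ : ∀ x, x ∈ LinearMap.ker φ ↔ ∀ i < 2 * l, ω x (u i) = 0 := fun x => by
    rw [LinearMap.mem_ker, funext_iff]
    exact ⟨fun h i hi => h ⟨i, hi⟩, fun h i => h i i.2⟩
  have hdim := φ.finrank_range_add_finrank_ker
  generalize LinearMap.ker φ = R at hφ hdim
  let z' : R := ⟨z, (hφ z).2 fun i _ => hωz _⟩
  have hz' : LinearIndependent k ![z'] := by
    simpa [z', Subtype.ext_iff] using hz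
  obtain ⟨d, c, hc⟩ := hz'.exists_basis_sum
  have hspan : Submodule.span k (Set.range fun i => (c i : Fin n → k)) = R := by
    have := congrArg (Submodule.map R.subtype) c.span_eq
    rw [Submodule.map_span, ← Set.range_comp, Submodule.map_subtype_top] at this
    exact this
  have hli : LinearIndependent k
      (Sum.elim (fun i : Fin (2 * l) => u i) fun i => (c i : Fin n → k)) := by
    refine (linearIndependent_of_hypGram hu).sum_type
      (c.linearIndependent.map' R.subtype R.ker_subtype) ?_
    have h : Disjoint (Submodule.span k (Set.range fun i : Fin (2 * l) => u i))
        R := by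
      rw [Submodule.disjoint_def]
      intro x hx hx'
      obtain ⟨a, rfl⟩ := (Submodule.mem_span_range_iff_exists_fun k).1 hx
      rw [coeff_eq_zero_of_hypGram hu ((hφ _).1 hx')]
      simp
    rw [← hspan] at h
    exact h
  obtain rfl : n = 2 * l + (1 + d) := by
    have h1 := hli.fintype_card_le_finrank
    have h3 := Submodule.finrank_le (LinearMap.range φ)
    have h4 := Module.finrank_eq_card_basis c
    simp only [Fintype.card_sum, Fintype.card_fin, Module.finrank_fin_fun] at h1 hdim h3 h4
    omega
  let e : Fin (2 * l) ⊕ (Fin 1 ⊕ Fin d) ≃ Fin (2 * l + (1 + d)) :=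
    (Equiv.sumCongr (Equiv.refl _) finSumFinEquiv).trans finSumFinEquiv
  have hl : 2 * l < 2 * l + (1 + d) := by omega
  refine ⟨hl, (mem_orbit_etaStr_iff hl).2 ?_⟩
  let b := (basisOfLinearIndependentOfCardEqFinrank hli (by simp)).reindex e
  have hb : ∀ s, b (e s) = Sum.elim (fun i : Fin (2 * l) => u i) (fun i => (c i : _ → k)) s :=
    fun s => by simp [b]
  have hbz : b ⟨2 * l, hl⟩ = z := by
    have : (⟨2 * l, hl⟩ : Fin (2 * l + (1 + d))) = e (Sum.inr (Sum.inl 0)) := by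
      ext; simp [e]
    rw [this, hb]
    simp [hc, z']
  have hel : ∀ i, (e (Sum.inl i) : ℕ) = i := fun i => by simp [e]
  have her : ∀ i, ¬ (e (Sum.inr i) : ℕ) < 2 * l := fun i => by simp [e]
  have hcr : ∀ i y, ω (c i) y = 0 := fun i => hrad _ ((hφ _).1 (c i).2)
  refine ⟨b, fun i j => ?_⟩
  obtain ⟨i, rfl⟩ := e.surjective i
  obtain ⟨j, rfl⟩ := e.surjective j
  rw [hbz, hμ, hb, hb]
  congr 1
  rcases i with i | i
  · rcases j with j | j
    · rw [truncGram, hel, hel, if_pos ⟨i.2, j.2⟩]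
      exact hu i i.2 j j.2
    · rw [truncGram, if_neg fun h => her j h.2, hskew]
      simp [hcr]
  · rw [truncGram, if_neg fun h => her i h.1]
    simp [hcr]

theorem exists_mem_orbit_etaStr {n : ℕ} {μ : AlgStr k n} (hμ0 : μ ≠ 0) (halt : ∀ x, μ x x = 0)
    (hminor : ∀ x y x' y' i j, μ x y i * μ x' y' j = μ x y j * μ x' y' i)
    (hnil : ∀ x y w, μ (μ x y) w = 0) :
    ∃ l, 1 ≤ l ∧ 2 * l < n ∧ μ ∈ orbit (etaStr n l) := by
  obtain ⟨x₀, y₀, hz⟩ : ∃ x y, μ x y ≠ 0 := by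
    by_contra! h
    exact hμ0 (LinearMap.ext fun x => LinearMap.ext fun y => h x y)
  obtain ⟨r, hr⟩ := Function.ne_iff.1 hz
  let ω : (Fin n → k) →ₗ[k] (Fin n → k) →ₗ[k] k := (μ x₀ y₀ r)⁻¹ • μ.compr₂ (LinearMap.proj r)
  have hω : ∀ x y, ω x y = (μ x₀ y₀ r)⁻¹ * μ x y r := fun x y => rfl
  have hμ : ∀ x y, μ x y = ω x y • μ x₀ y₀ := by
    intro x y
    funext j
    have := hminor x y x₀ y₀ j r
    rw [Pi.smul_apply, hω, smul_eq_mul, mul_assoc, ← this, mul_comm (μ x y j),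
      inv_mul_cancel_left₀ hr]
  have halt' : ∀ x, ω x x = 0 := fun x => by simp [hω, halt]
  obtain ⟨l, u, hu, hrad⟩ := exists_hypGram_maximal halt'
  obtain ⟨hl, hmem⟩ := mem_orbit_etaStr_of_hypGram hz (fun y => by simp [hω, hnil]) halt' hμ hu hrad
  refine ⟨l, Nat.one_le_iff_ne_zero.2 ?_, hl, hmem⟩
  rintro rfl
  exact hz (by rw [hμ, hrad x₀ (by simp) y₀, zero_smul])

theorem exists_linearMap_of_mem_orbit_etaStr {n m : ℕ} (hm : 2 * m < n) {μ : AlgStr k n}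
    (h : μ ∈ orbit (etaStr n m)) :
    ∃ (ω : (Fin n → k) →ₗ[k] (Fin n → k) →ₗ[k] k) (z : Fin n → k)
      (φ : (Fin n → k) →ₗ[k] (Fin (2 * m) → k)),
      (∀ x y, μ x y = ω x y • z) ∧ (∀ x, ω x x = 0) ∧ (∀ y, ω z y = 0) ∧
        ∀ x, φ x = 0 → ∀ y, ω x y = 0 := by
  obtain ⟨b, hb⟩ := (mem_orbit_etaStr_iff hm).1 h
  let ω : (Fin n → k) →ₗ[k] (Fin n → k) →ₗ[k] k :=
    μ.compr₂ (b.coord ⟨2 * m, hm⟩)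
  have hω : ∀ i j, ω (b i) (b j) = truncGram k m i j := fun i j => by
    simp [ω, hb]
  have hrow : ∀ i : Fin n, ¬ (i : ℕ) < 2 * m → ∀ y, ω (b i) y = 0 := fun i hi y => by
    have : ω (b i) = 0 := b.ext fun j => by simp [hω, truncGram, hi]
    rw [this, LinearMap.zero_apply]
  refine ⟨ω, b ⟨2 * m, hm⟩, LinearMap.pi fun i => b.coord ⟨i, by omega⟩, fun x y => ?_, fun x => ?_,
    hrow _ (by simp), fun x hx y => ?_⟩
  · have : μ = ω.compr₂ (LinearMap.toSpanSingleton k _ (b ⟨2 * m, hm⟩)) :=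
      b.ext fun i => b.ext fun j => by simp [hb, hω]
    conv_lhs => rw [this]
    simp
  · have hneg : ω = -ω.flip := b.ext fun i => b.ext fun j => by
      simp only [hω, LinearMap.neg_apply, LinearMap.flip_apply, truncGram, hypGram_swap (j : ℕ) i]
      split_ifs <;> first | omega | simp
    have hskew : ∀ x y, ω x y = -ω y x := fun x y => LinearMap.congr_fun₂ hneg x y
    induction b.mem_span x using Submodule.span_induction with
    | mem x hx =>
      obtain ⟨i, rfl⟩ := hx
      rw [hω, truncGram, hypGram_self, ite_self]
    | zero => simp
    | add x y _ _ hx hy =>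
      simp only [map_add, LinearMap.add_apply, hx, hy, hskew x y]
      simp
    | smul c x _ hx => simp [hx]
  · rw [← b.sum_repr x, map_sum, LinearMap.sum_apply]
    refine Finset.sum_eq_zero fun i _ => ?_
    rw [map_smul, LinearMap.smul_apply]
    by_cases hi : (i : ℕ) < 2 * m
    · have := congrFun hx ⟨i, hi⟩
      simp at this
      rw [this, zero_smul]
    · rw [hrow i hi, smul_zero]

theorem le_of_mem_zclosure_orbit_etaStr {n m l : ℕ} (hm : 2 * m < n) (hl : 2 * l < n)
    {χ : AlgStr k n} (hχ : χ ∈ zclosure (orbit (etaStr n m))) (hχl : χ ∈ orbit (etaStr n l)) :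
    l ≤ m := by
  by_contra! hlm
  obtain ⟨b, hb⟩ := (mem_orbit_etaStr_iff hl).1 hχl
  obtain ⟨r, hr⟩ := Function.ne_iff.1 (b.ne_zero ⟨2 * l, hl⟩)
  have hp : ∀ i : Fin (2 * m + 1), hypPartner i < 2 * l := fun i =>
    hypPartner_lt_iff.2 (by omega)
  let x : Fin (2 * m + 1) → Fin n → k := fun i => b ⟨i, by omega⟩
  let y : Fin (2 * m + 1) → Fin n → k := fun i => b ⟨hypPartner i, by have := hp i; omega⟩
  let M : AlgStr k n → Matrix (Fin (2 * m + 1)) (Fin (2 * m + 1)) k := fun μ =>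
    Matrix.of fun i j => μ (x i) (y j) r
  have hM : IsPolyFun fun μ => (M μ).det := .det fun i j => .apply _ _ _
  have hdet : (M χ).det = 0 := by
    refine hM.eq_zero_of_mem_zclosure (fun μ hμ => ?_) hχ
    obtain ⟨ω, z, φ, hμω, -, -, hφ⟩ := exists_linearMap_of_mem_orbit_etaStr hm hμ
    have hdep : ¬ LinearIndependent k (φ ∘ x) := fun h => by
      have := h.fintype_card_le_finrank
      simp at this
    obtain ⟨v, hv, i, hvi⟩ := Fintype.not_linearIndependent_iff.1 hdep
    refine Matrix.exists_vecMul_eq_zero_iff.1 ⟨v, fun h => hvi (congrFun h i), ?_⟩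
    funext j
    have h0 := hφ (∑ i, v i • x i) (by simpa using hv) (y j)
    have h1 : μ (∑ i, v i • x i) (y j) r = 0 := by rw [hμω, h0]; simp
    simpa [Matrix.vecMul, dotProduct, M, LinearMap.sum_apply, Finset.sum_apply] using h1
  have hdiag : M χ = Matrix.diagonal fun i : Fin (2 * m + 1) =>
      hypGram k i (hypPartner i) * b ⟨2 * l, hl⟩ r := by
    ext i j
    have : M χ i j = hypGram k i (hypPartner j) * b ⟨2 * l, hl⟩ r := by
      simp only [M, Matrix.of_apply, x, y, hb, truncGram]
      rw [if_pos ⟨by omega, hp j⟩, Pi.smul_apply, smul_eq_mul]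
    rw [this]
    by_cases hij : i = j
    · rw [hij, Matrix.diagonal_apply_eq]
    · rw [Matrix.diagonal_apply_ne _ hij, hypGram_eq_zero fun h => hij (Fin.ext h), zero_mul]
  rw [hdiag, Matrix.det_diagonal, Finset.prod_eq_zero_iff] at hdet
  obtain ⟨i, -, hi⟩ := hdet
  have := hypGram_mul_self (k := k) i
  rw [(mul_eq_zero.1 hi).resolve_right hr, zero_mul] at this
  exact zero_ne_one this

theorem zclosure_orbit_etaStr [Infinite k] {n m : ℕ} (hm : 2 * m < n) :
    zclosure (orbit (etaStr (k := k) n m)) =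
      (⋃ l ∈ Set.Icc 1 m, orbit (etaStr (k := k) n l)) ∪ orbit (0 : AlgStr k n) := by
  refine Set.Subset.antisymm (fun χ hχ => ?_) (Set.union_subset ?_ ?_)
  · by_cases h0 : χ = 0
    · exact .inr (mem_orbit_zero.2 h0)
    · left
      obtain ⟨l, hl1, hln, hl⟩ := exists_mem_orbit_etaStr h0
        (fun x => funext fun r => (IsPolyFun.apply x x r).eq_zero_of_mem_zclosure
          (fun μ hμ => by
            obtain ⟨ω, z, φ, hμω, halt, -, -⟩ := exists_linearMap_of_mem_orbit_etaStr hm hμ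
            simp [hμω, halt]) hχ)
        (fun x y x' y' i j => sub_eq_zero.1 <|
          (((IsPolyFun.apply x y i).mul (.apply x' y' j)).sub
            ((IsPolyFun.apply x y j).mul (.apply x' y' i))).eq_zero_of_mem_zclosure
          (fun μ hμ => by
            obtain ⟨ω, z, φ, hμω, -, -, -⟩ := exists_linearMap_of_mem_orbit_etaStr hm hμ
            simp only [hμω, Pi.smul_apply, smul_eq_mul]
            ring) hχ)
        (fun x y w => funext fun r => (IsPolyFun.apply_apply x y w r).eq_zero_of_mem_zclosure
          (fun μ hμ => by
            obtain ⟨ω, z, φ, hμω, -, hz, -⟩ := exists_linearMap_of_mem_orbit_etaStr hm hμ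
            simp [hμω, hz]) hχ)
      exact Set.mem_biUnion ⟨hl1, le_of_mem_zclosure_orbit_etaStr hm hln hχ hl⟩ hl
  · exact Set.iUnion₂_subset fun l hl => orbit_etaStr_subset_zclosure hl.2 hm
  · rw [← etaStr_zero]
    exact orbit_etaStr_subset_zclosure (Nat.zero_le m) hm

/-! ## STATEMENT 10 -/
theorem stmt10 {k : Type*} [Field k] [IsAlgClosed k] :
    (∀ n : ℕ, 2 ≤ n →
      zclosure (orbit (kE4str (k := k) n)) =
        orbit (kE4str n) ∪ orbit (pminusStr n) ∪ orbit (0 : AlgStr k n) ∪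
          ⋃ α : k, orbit (nuStr n α)) ∧
    (∀ m n : ℕ, 1 ≤ m → 2 * m + 1 ≤ n →
      zclosure (orbit (etaStr (k := k) n m)) =
        (⋃ l ∈ Set.Icc 1 m, orbit (etaStr (k := k) n l)) ∪ orbit (0 : AlgStr k n)) :=
  ⟨fun _ hn => zclosure_orbit_kE4str hn, fun _ _ _ hmn => zclosure_orbit_etaStr hmn⟩

end
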